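/- arXiv:1310.0707 — 2 statements merged into one kernel-verified Lean document; each statement's English description precedes it below -/
import Mathlib

section
/- Let f, r : ℝ → ℝ be of class C². For every A > 0 and T > 0 there is a constant B > 0, depending only on A, T and r, such that: if y is a classical solution of y_t + (f(y))_x = y_xx + r(y) on [0,1] × (0,T) with homogeneous Dirichlet boundary conditions and sup_{x∈[0,1]} |y(x,0)| ≤ A, then sup_{x∈[0,1]} |y(x,t)| ≤ B for all 0 ≤ t < T. (Here it is assumed the growth condition ∫_{-∞}^0 dy/(|r(y)|+1) = ∫_0^∞ dy/(|r(y)|+1) = ∞ holds.) -/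
open Set MeasureTheory

/-- `y` is a classical solution of `y_t + (f(y))_x = y_xx + r(y)` on `[0,1] × (0,T)`
with homogeneous Dirichlet boundary conditions: continuous in both variables on
`[0,1] × [0,T)`, `C²` in `x` and differentiable in `t` on the open time interval,
satisfying the equation pointwise on `(0,1) × (0,T)`. -/
def IsClassicalSolutionOn (f r : ℝ → ℝ) (T : ℝ) (y : ℝ → ℝ → ℝ) : Prop :=
  ContinuousOn (fun pt : ℝ × ℝ => y pt.1 pt.2) (Icc 0 1 ×ˢ Ico 0 T) ∧
  (∀ t ∈ Ioo (0:ℝ) T, ContDiffOn ℝ 2 (fun x => y x t) (Icc 0 1)) ∧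
  (∀ t ∈ Ico (0:ℝ) T, y 0 t = 0 ∧ y 1 t = 0) ∧
  (∀ x ∈ Ioo (0:ℝ) 1, ∀ t ∈ Ioo (0:ℝ) T,
    HasDerivAt (fun s => y x s)
      (deriv (deriv (fun x' => y x' t)) x - deriv (fun x' => f (y x' t)) x + r (y x t)) t)

open Filter Topology

/-- At a local maximum the second derivative is nonpositive. -/
theorem IsLocalMax.deriv_deriv_nonpos {u : ℝ → ℝ} {x : ℝ} (h : IsLocalMax u x)
    (hc : ContinuousAt u x) : deriv (deriv u) x ≤ 0 := by
  by_contra! hpos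
  have hmin := isLocalMin_of_deriv_deriv_pos hpos h.deriv_eq_zero hc
  have hconst : u =ᶠ[𝓝 x] fun _ => u x := by
    filter_upwards [h, hmin] with z hz hz' using le_antisymm hz hz'
  have hd := hconst.deriv.deriv_eq
  simp only [deriv_const', deriv_const] at hd
  exact hpos.ne' hd

/-- The derivative is nonnegative at the right endpoint of an interval on which the function
is bounded above by its value there. -/
theorem HasDerivAt.nonneg_of_forall_le_left {φ : ℝ → ℝ} {d a t : ℝ} (hd : HasDerivAt φ d t)
    (hat : a < t) (hle : ∀ s ∈ Ioo a t, φ s ≤ φ t) : 0 ≤ d := by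
  have htend := (hasDerivWithinAt_iff_tendsto_slope' (notMem_Iio.2 le_rfl)).1
    (hd.hasDerivWithinAt (s := Iio t))
  refine ge_of_tendsto htend ?_
  filter_upwards [Ioo_mem_nhdsLT hat] with s hs
  rw [slope_def_field]
  exact div_nonneg_of_nonpos (sub_nonpos.2 (hle s hs)) (sub_nonpos.2 hs.2.le)

/-- A continuous nonnegative function with infinite integral over `[0, ∞)` has arbitrarily large
integrals over bounded intervals. -/
theorem exists_intervalIntegral_gt_of_lintegral_eq_top {g : ℝ → ℝ} (hg : Continuous g)
    (hg0 : ∀ s, 0 ≤ g s) (htop : ∫⁻ s in Ici (0:ℝ), ENNReal.ofReal (g s) = ⊤) (C : ℝ) :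
    ∃ b : ℝ, C < ∫ s in (0:ℝ)..b, g s := by
  by_contra! h
  have hint : IntegrableOn g (Ioi 0) := by
    refine integrableOn_Ioi_of_intervalIntegral_norm_bounded (l := atTop) C 0
      (b := fun b : ℝ => b) (fun b => ?_) tendsto_id (Eventually.of_forall fun b => ?_)
    · exact (hg.integrableOn_Icc).mono_set Ioc_subset_Icc_self
    · simpa [Real.norm_of_nonneg (hg0 _)] using h b
  rw [← setLIntegral_congr Ioi_ae_eq_Ici] at htop
  exact hint.lintegral_lt_top.ne htop

/-- Diffusion minus convection is nonpositive at a local maximum. -/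
theorem IsLocalMax.deriv_deriv_sub_deriv_comp_nonpos {f u : ℝ → ℝ} {x : ℝ} (h : IsLocalMax u x)
    (hf : Differentiable ℝ f) (hu : DifferentiableAt ℝ u x) :
    deriv (deriv u) x - deriv (fun z => f (u z)) x ≤ 0 := by
  have hcomp : deriv (fun z => f (u z)) x = 0 := by
    have := deriv_comp x (hf (u x)) hu
    rw [h.deriv_eq_zero, mul_zero] at this
    exact this
  rw [hcomp, sub_zero]
  exact h.deriv_deriv_nonpos hu.continuousAt

/-- Comparison with the flow of `z' = |r z| + 1`. -/
theorem IsClassicalSolutionOn.intervalIntegral_le {f r : ℝ → ℝ} {T A : ℝ} {y : ℝ → ℝ → ℝ}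
    (hf : Differentiable ℝ f) (hr : Continuous r) (hA : 0 ≤ A)
    (hy : IsClassicalSolutionOn f r T y) (hy0 : ∀ x ∈ Icc (0:ℝ) 1, y x 0 ≤ A)
    {x t : ℝ} (hx : x ∈ Icc (0:ℝ) 1) (ht : t ∈ Ico (0:ℝ) T) :
    ∫ s in (0:ℝ)..y x t, 1 / (|r s| + 1) ≤ (∫ s in (0:ℝ)..A, 1 / (|r s| + 1)) + t := by
  obtain ⟨hcont, hreg, hbd, heq⟩ := hy
  have hpos : ∀ s, 0 < |r s| + 1 := fun s => by positivity
  have hg : Continuous fun s => 1 / (|r s| + 1) :=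
    continuous_const.div (hr.abs.add continuous_const) fun s => (hpos s).ne'
  set G : ℝ → ℝ := fun z => ∫ s in (0:ℝ)..z, 1 / (|r s| + 1) with hG
  have hGd : ∀ z, HasDerivAt G (1 / (|r z| + 1)) z := fun z => hg.integral_hasStrictDerivAt 0 z
    |>.hasDerivAt
  have hGc : Continuous G := continuous_iff_continuousAt.2 fun z => (hGd z).continuousAt
  have hGm : StrictMono G := strictMono_of_deriv_pos fun z => by
    rw [(hGd z).deriv]; exact one_div_pos.2 (hpos z)
  have hG0 : G 0 = 0 := by simp [hG]
  have hGA : 0 ≤ G A := hG0 ▸ hGm.monotone hA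
  change G (y x t) ≤ G A + t
  by_contra! hlt
  have hsub : Icc (0:ℝ) 1 ×ˢ Icc 0 t ⊆ Icc (0:ℝ) 1 ×ˢ Ico 0 T :=
    prod_mono_right fun s hs => ⟨hs.1, hs.2.trans_lt ht.2⟩
  obtain ⟨⟨x₀, t₀⟩, ⟨hx₀, ht₀⟩, hmax⟩ := (isCompact_Icc.prod isCompact_Icc).exists_isMaxOn
    (s := Icc (0:ℝ) 1 ×ˢ Icc 0 t) ⟨(x, t), hx, ht.1, le_rfl⟩
    (f := fun p : ℝ × ℝ => G (y p.1 p.2) - p.2)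
    ((hGc.comp_continuousOn (hcont.mono hsub)).sub continuous_snd.continuousOn)
  have hle : ∀ z ∈ Icc (0:ℝ) 1, ∀ s ∈ Icc 0 t, G (y z s) - s ≤ G (y x₀ t₀) - t₀ :=
    fun z hz s hs => hmax (show (z, s) ∈ Icc (0:ℝ) 1 ×ˢ Icc 0 t from ⟨hz, hs⟩)
  simp only at hx₀ ht₀
  have hbig : G A < G (y x₀ t₀) - t₀ := by
    linarith [hle x hx t ⟨ht.1, le_rfl⟩]
  have ht₀T : t₀ < T := ht₀.2.trans_lt ht.2
  have ht₀pos : 0 < t₀ := by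
    refine lt_of_le_of_ne ht₀.1 fun h => ?_
    subst h
    linarith [hGm.monotone (hy0 x₀ hx₀)]
  have hbd₀ := hbd t₀ ⟨ht₀.1, ht₀T⟩
  have hx₀' : x₀ ∈ Ioo (0:ℝ) 1 := by
    refine ⟨lt_of_le_of_ne hx₀.1 fun h => ?_, lt_of_le_of_ne hx₀.2 fun h => ?_⟩
    · rw [← h, hbd₀.1, hG0] at hbig; linarith [ht₀.1]
    · rw [h, hbd₀.2, hG0] at hbig; linarith [ht₀.1]
  have hnhds : Icc (0:ℝ) 1 ∈ 𝓝 x₀ := Icc_mem_nhds hx₀'.1 hx₀'.2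
  have hloc : IsLocalMax (fun z => y z t₀) x₀ := by
    filter_upwards [hnhds] with z hz
    exact hGm.le_iff_le.1 (by linarith [hle z hz t₀ ht₀])
  have hdiff : DifferentiableAt ℝ (fun z => y z t₀) x₀ :=
    ((hreg t₀ ⟨ht₀pos, ht₀T⟩).contDiffAt hnhds).differentiableAt (by norm_num)
  have hspace := hloc.deriv_deriv_sub_deriv_comp_nonpos hf hdiff
  have htime := ((hGd (y x₀ t₀)).comp t₀ (heq x₀ hx₀' t₀ ⟨ht₀pos, ht₀T⟩)).sub (hasDerivAt_id t₀)
  have hnn := htime.nonneg_of_forall_le_left ht₀pos fun s hs =>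
    hle x₀ hx₀ s ⟨hs.1.le, hs.2.le.trans ht₀.2⟩
  rw [sub_nonneg, one_div_mul_eq_div, le_div_iff₀ (hpos _)] at hnn
  linarith [le_abs_self (r (y x₀ t₀))]

/-- One-sided uniform bound for classical solutions. -/
theorem exists_forall_isClassicalSolutionOn_le {r : ℝ → ℝ} (hr : Continuous r)
    (hgrowth : ∫⁻ s in Ici (0:ℝ), ENNReal.ofReal (1 / (|r s| + 1)) = ⊤)
    {A : ℝ} (T : ℝ) (hA : 0 ≤ A) :
    ∃ B : ℝ, ∀ f : ℝ → ℝ, Differentiable ℝ f → ∀ y : ℝ → ℝ → ℝ, IsClassicalSolutionOn f r T y →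
      (∀ x ∈ Icc (0:ℝ) 1, y x 0 ≤ A) →
      ∀ x ∈ Icc (0:ℝ) 1, ∀ t ∈ Ico (0:ℝ) T, y x t ≤ B := by
  have hg0 : ∀ s, 0 ≤ 1 / (|r s| + 1) := fun s => by positivity
  have hg : Continuous fun s => 1 / (|r s| + 1) :=
    continuous_const.div (hr.abs.add continuous_const) fun s => by positivity
  obtain ⟨B, hB⟩ := exists_intervalIntegral_gt_of_lintegral_eq_top hg hg0 hgrowth
    ((∫ s in (0:ℝ)..A, 1 / (|r s| + 1)) + T)
  refine ⟨B, fun f hf y hy hy0 x hx t ht => ?_⟩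
  by_contra! hlt
  have hle := hy.intervalIntegral_le hf hr hA hy0 hx ht
  have hadd := intervalIntegral.integral_add_adjacent_intervals
    (hg.intervalIntegrable (μ := volume) 0 B) (hg.intervalIntegrable B (y x t))
  have hnn := intervalIntegral.integral_nonneg (μ := volume) hlt.le fun s _ => hg0 s
  linarith [ht.2]

/-- The reflection `y ↦ -y` maps classical solutions to classical solutions. -/
theorem IsClassicalSolutionOn.neg {f r : ℝ → ℝ} {T : ℝ} {y : ℝ → ℝ → ℝ}
    (hy : IsClassicalSolutionOn f r T y) :
    IsClassicalSolutionOn (fun z => -f (-z)) (fun z => -r (-z)) T (fun x t => -y x t) := by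
  obtain ⟨hcont, hreg, hbd, heq⟩ := hy
  refine ⟨hcont.neg, fun t ht => (hreg t ht).neg, fun t ht => ?_, fun x hx t ht => ?_⟩
  · simp [hbd t ht]
  · refine (heq x hx t ht).fun_neg.congr_deriv ?_
    have h₁ : (deriv fun x' => -y x' t) = fun x' => -deriv (fun x' => y x' t) x' :=
      deriv.fun_neg'
    have h₂ : deriv (fun x' => -deriv (fun x' => y x' t) x') x
        = -deriv (deriv fun x' => y x' t) x := deriv.fun_neg
    have h₃ : deriv (fun x' => -f (y x' t)) x = -deriv (fun x' => f (y x' t)) x := deriv.fun_neg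
    simp only [neg_neg]
    rw [h₁, h₂, h₃]
    ring

/-- uniform pointwise bound for classical solutions, with a constant
depending only on `A`, `T` and `r`. -/
theorem uniform_pointwise_bound
    (r : ℝ → ℝ) (hr : ContDiff ℝ 2 r)
    (hgrowth₁ : ∫⁻ s in Iic (0:ℝ), ENNReal.ofReal (1 / (|r s| + 1)) = ⊤)
    (hgrowth₂ : ∫⁻ s in Ici (0:ℝ), ENNReal.ofReal (1 / (|r s| + 1)) = ⊤)
    (A T : ℝ) (hA : 0 < A) (hT : 0 < T) :
    ∃ B > 0, ∀ f : ℝ → ℝ, ContDiff ℝ 2 f → ∀ y : ℝ → ℝ → ℝ,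
      IsClassicalSolutionOn f r T y →
      (∀ x ∈ Icc (0:ℝ) 1, |y x 0| ≤ A) →
      ∀ x ∈ Icc (0:ℝ) 1, ∀ t ∈ Ico (0:ℝ) T, |y x t| ≤ B := by
  have hreflect : ∫⁻ s in Ici (0:ℝ), ENNReal.ofReal (1 / (|-r (-s)| + 1)) = ⊤ := by
    rw [← hgrowth₁]
    have := (Measure.measurePreserving_neg (volume : Measure ℝ)).setLIntegral_comp_preimage_emb
      (Homeomorph.neg ℝ).measurableEmbedding
      (fun s => ENNReal.ofReal (1 / (|r s| + 1))) (Iic 0)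
    simpa using this
  obtain ⟨B₁, hB₁⟩ := exists_forall_isClassicalSolutionOn_le hr.continuous hgrowth₂ T hA.le
  obtain ⟨B₂, hB₂⟩ := exists_forall_isClassicalSolutionOn_le
    (r := fun z => -r (-z)) (hr.continuous.comp continuous_neg).neg hreflect T hA.le
  refine ⟨max 1 (max B₁ B₂), by positivity, fun f hf y hy hy0 x hx t ht => ?_⟩
  have hfd : Differentiable ℝ f := hf.differentiable (by norm_num)
  have hup := hB₁ f hfd y hy (fun z hz => (abs_le.1 (hy0 z hz)).2) x hx t ht
  have hlow := hB₂ _ (hfd.comp differentiable_neg).neg _ hy.neg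
    (fun z hz => (neg_le_abs _).trans (hy0 z hz)) x hx t ht
  exact (abs_le'.2 ⟨hup.trans (le_max_left _ _), hlow.trans (le_max_right _ _)⟩).trans
    (le_max_right _ _)
end

section
/- Let f, r : ℝ → ℝ be of class C², let B > 0, and set R₁(B) = sup_{|s|≤B} |r'(s)|, F₁(B) = sup_{|s|≤B} |f'(s)|, and β = R₁(B) + F₁(B)²/4. Let y be a classical solution of y_t + (f(y))_x = y_xx + r(y) on [0,1] × (0,τ] with homogeneous Dirichlet boundary conditions satisfying |y(x,t)| ≤ B, and let p be a classical solution on [0,1] × [0,τ] of the backward adjoint equation −p_t − f'(y) p_x = p_xx + r'(y) p with homogeneous Dirichlet boundary conditions. Then ‖p(·,t)‖ ≤ ‖p(·,τ)‖ e^{β(τ−t)} for all 0 ≤ t ≤ τ, where ‖·‖ denotes the L²(0,1) norm. -/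
open Set MeasureTheory intervalIntegral

/-- `y` is a classical solution of `y_t + (f(y))_x = y_xx + r(y)` on `[0,1] × (0,τ]`
with homogeneous Dirichlet boundary conditions. -/
def IsClassicalSolutionOnIoc (f r : ℝ → ℝ) (τ : ℝ) (y : ℝ → ℝ → ℝ) : Prop :=
  ContinuousOn (fun pt : ℝ × ℝ => y pt.1 pt.2) (Icc 0 1 ×ˢ Icc 0 τ) ∧
  (∀ t ∈ Ioc (0:ℝ) τ, ContDiffOn ℝ 2 (fun x => y x t) (Icc 0 1)) ∧
  (∀ t ∈ Icc (0:ℝ) τ, y 0 t = 0 ∧ y 1 t = 0) ∧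
  (∀ x ∈ Ioo (0:ℝ) 1, ∀ t ∈ Ioc (0:ℝ) τ,
    HasDerivWithinAt (fun s => y x s)
      (deriv (deriv (fun x' => y x' t)) x - deriv (fun x' => f (y x' t)) x + r (y x t))
      (Iic τ) t)

/-- `p` is a classical solution of the backward adjoint equation
`−p_t − f'(y) p_x = p_xx + r'(y) p` on `[0,1] × [0,τ]` with homogeneous Dirichlet
boundary conditions. -/
def IsAdjointSolutionOn (f r : ℝ → ℝ) (y : ℝ → ℝ → ℝ) (τ : ℝ) (p : ℝ → ℝ → ℝ) : Prop :=
  ContinuousOn (fun pt : ℝ × ℝ => p pt.1 pt.2) (Icc 0 1 ×ˢ Icc 0 τ) ∧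
  (∀ t ∈ Icc (0:ℝ) τ, ContDiffOn ℝ 2 (fun x => p x t) (Icc 0 1)) ∧
  (∀ t ∈ Icc (0:ℝ) τ, p 0 t = 0 ∧ p 1 t = 0) ∧
  (∀ x ∈ Ioo (0:ℝ) 1, ∀ t ∈ Icc (0:ℝ) τ,
    HasDerivWithinAt (fun s => p x s)
      (-(deriv (deriv (fun x' => p x' t)) x) - deriv f (y x t) * deriv (fun x' => p x' t) x
        - deriv r (y x t) * p x t) (Icc 0 τ) t)

open Filter Topology

/-- `(a, b)` is a second-order subjet of `Q` at `x`: up to second order, `Q` lies above the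
parabola with slope `a` and curvature `b` touching it at `x`. -/
def IsSubjet (Q : ℝ → ℝ) (x a b : ℝ) : Prop :=
  ∀ b' < b, ∀ᶠ z in 𝓝 x, Q x + a * (z - x) + b' / 2 * (z - x) ^ 2 ≤ Q z

lemma isSubjet_deriv {φ : ℝ → ℝ} {x : ℝ} (hd : ∀ᶠ z in 𝓝 x, DifferentiableAt ℝ φ z)
    (hdd : DifferentiableAt ℝ (deriv φ) x) :
    IsSubjet φ x (deriv φ x) (deriv (deriv φ) x) := by
  intro b' hb'
  set a := deriv φ x with ha
  set k : ℝ → ℝ := fun z => φ z - (φ x + a * (z - x) + b' / 2 * (z - x) ^ 2) with hk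
  have hpol : ∀ z : ℝ, HasDerivAt (fun z => φ x + a * (z - x) + b' / 2 * (z - x) ^ 2)
      (a + b' * (z - x)) z := by
    intro z
    have h1 := (hasDerivAt_id z).sub_const x
    have := ((h1.const_mul a).const_add (φ x)).add ((h1.pow 2).const_mul (b' / 2))
    convert! this using 1
    simp only [id]; ring
  have hk1 : deriv k =ᶠ[𝓝 x] fun z => deriv φ z - (a + b' * (z - x)) := by
    filter_upwards [hd] with z hz
    exact (hz.hasDerivAt.sub (hpol z)).deriv
  have hk2 : deriv (deriv k) x = deriv (deriv φ) x - b' := by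
    rw [hk1.deriv_eq]
    have h1 := (((hasDerivAt_id x).sub_const x).const_mul b').const_add a
    have := (hdd.hasDerivAt.sub h1).deriv
    simpa using! this
  have hmin : IsLocalMin k x := by
    apply isLocalMin_of_deriv_deriv_pos
    · rw [hk2]; linarith
    · rw [hk1.self_of_nhds]; simp [ha]
    · exact (hd.self_of_nhds.hasDerivAt.sub (hpol x)).continuousAt
  filter_upwards [hmin] with z hz
  simp only [hk] at hz
  simp only [sub_self, mul_zero, ne_eq, OfNat.ofNat_ne_zero, not_false_eq_true, zero_pow,
    add_zero] at hz
  linarith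

lemma IsSubjet.of_eventually_le {φ Q : ℝ → ℝ} {x a b : ℝ} (h : IsSubjet φ x a b)
    (hle : ∀ᶠ z in 𝓝 x, Q x - φ x ≤ Q z - φ z) : IsSubjet Q x a b := by
  intro b' hb'
  filter_upwards [h b' hb', hle] with z h1 h2
  linarith

lemma IsSubjet.comp_neg {Q : ℝ → ℝ} {x a b : ℝ} (h : IsSubjet Q (-x) a b) :
    IsSubjet (fun z => Q (-z)) x (-a) b := by
  intro b' hb'
  have ht : Tendsto (fun z : ℝ => -z) (𝓝 x) (𝓝 (-x)) := continuous_neg.tendsto x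
  filter_upwards [ht.eventually (h b' hb')] with z hz
  have e : Q (-x) + a * (-z - -x) + b' / 2 * (-z - -x) ^ 2
      = Q (-x) + -a * (z - x) + b' / 2 * (z - x) ^ 2 := by ring
  linarith

lemma isSubjet_zero {Q : ℝ → ℝ} (hQ : ∀ x, 0 ≤ Q x) {x : ℝ} (hx : Q x = 0) :
    IsSubjet Q x 0 0 := by
  intro b' hb'
  filter_upwards with z
  nlinarith [hQ z, sq_nonneg (z - x)]

/-- Touching a function with a subjet from above by a twice differentiable function. -/
lemma IsSubjet.of_isLocalMax_sub {Q ψ ψ' ψ'' : ℝ → ℝ} {x a b : ℝ} (h : IsSubjet Q x a b)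
    (h1 : ∀ z, HasDerivAt ψ (ψ' z) z) (h2 : ∀ z, HasDerivAt ψ' (ψ'' z) z)
    (hmax : IsLocalMax (fun z => Q z - ψ z) x) : a = ψ' x ∧ b ≤ ψ'' x := by
  have key : ∀ b' < b, IsLocalMax (fun z => a * (z - x) + b' / 2 * (z - x) ^ 2 - ψ z) x := by
    intro b' hb'
    filter_upwards [h b' hb', hmax] with z hz hz'
    simp only [sub_self, mul_zero, ne_eq, OfNat.ofNat_ne_zero, not_false_eq_true, zero_pow,
      add_zero]
    linarith
  have hk : ∀ b' z : ℝ, HasDerivAt (fun z => a * (z - x) + b' / 2 * (z - x) ^ 2 - ψ z)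
      (a + b' * (z - x) - ψ' z) z := by
    intro b' z
    have h3 := (hasDerivAt_id z).sub_const x
    have := ((h3.const_mul a).add ((h3.pow 2).const_mul (b' / 2))).sub (h1 z)
    convert! this using 1
    simp only [id]; ring
  have ha : a = ψ' x := by
    have := (key (b - 1) (by linarith)).hasDerivAt_eq_zero (hk _ x)
    simp only [sub_self, mul_zero, add_zero] at this
    linarith
  refine ⟨ha, ?_⟩
  by_contra! hb
  obtain ⟨b', hb1, hb2⟩ := exists_between hb
  have hd1 : deriv (fun z => a * (z - x) + b' / 2 * (z - x) ^ 2 - ψ z)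
      = fun z => a + b' * (z - x) - ψ' z := funext fun z => (hk b' z).deriv
  have hd2 : HasDerivAt (fun z => a + b' * (z - x) - ψ' z) (b' - ψ'' x) x := by
    have := ((((hasDerivAt_id x).sub_const x).const_mul b').const_add a).sub (h2 x)
    convert! this using 1
    ring
  have hmin : IsLocalMin (fun z => a * (z - x) + b' / 2 * (z - x) ^ 2 - ψ z) x := by
    apply isLocalMin_of_deriv_deriv_pos
    · rw [hd1, hd2.deriv]; linarith
    · rw [hd1]; simp [ha]
    · exact (hk b' x).continuousAt
  have hconst : (fun z => a * (z - x) + b' / 2 * (z - x) ^ 2 - ψ z)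
      =ᶠ[𝓝 x] fun _ => a * (x - x) + b' / 2 * (x - x) ^ 2 - ψ x := by
    filter_upwards [hmin, key b' hb2] with z hz hz'
    exact le_antisymm hz' hz
  have h0 : deriv (deriv (fun z => a * (z - x) + b' / 2 * (z - x) ^ 2 - ψ z)) x = 0 := by
    rw [hconst.deriv.deriv_eq]
    simp
  rw [hd1, hd2.deriv] at h0
  linarith

/-- Comparison principle on an interval. -/
lemma le_of_isSubjet {Q ψ ψ' ψ'' : ℝ → ℝ} {l u : ℝ} (hQ : Continuous Q)
    (h1 : ∀ z, HasDerivAt ψ (ψ' z) z) (h2 : ∀ z, HasDerivAt ψ' (ψ'' z) z)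
    (hl : Q l ≤ ψ l) (hu : Q u ≤ ψ u)
    (H : ∀ x ∈ Ioo l u, ∃ a b, IsSubjet Q x a b ∧ (a = ψ' x → ψ'' x < b)) :
    ∀ x ∈ Icc l u, Q x ≤ ψ x := by
  intro x hx
  have hψ : Continuous ψ := continuous_iff_continuousAt.2 fun z => (h1 z).continuousAt
  obtain ⟨m, hm, hmax⟩ := isCompact_Icc.exists_isMaxOn ⟨x, hx⟩ (hQ.sub hψ).continuousOn
  have hxm : Q x - ψ x ≤ Q m - ψ m := hmax hx
  rcases eq_or_lt_of_le hm.1 with rfl | hlm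
  · linarith
  rcases eq_or_lt_of_le hm.2 with rfl | hmu
  · linarith
  obtain ⟨a, b, hab, hlt⟩ := H m ⟨hlm, hmu⟩
  obtain ⟨e1, e2⟩ := hab.of_isLocalMax_sub h1 h2 (hmax.isLocalMax (Icc_mem_nhds hlm hmu))
  exact absurd (hlt e1) (not_lt.2 e2)

lemma exists_growth_bound {F G M : ℝ} (hF : 0 ≤ F) (hG : 0 ≤ G) (hM : 0 ≤ M) :
    ∃ L : ℝ, 0 ≤ L ∧ ∀ Q : ℝ → ℝ, Continuous Q → (∀ x, 0 ≤ Q x) → (∀ x, Q x ≤ M) →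
      (∀ x, ∃ a b, IsSubjet Q x a b ∧ -G ≤ b + F * |a|) →
      ∀ x y, y ≤ x → Q x ≤ Q y + L * (x - y) := by
  set c : ℝ := F + 1 with hc
  have hc0 : 0 < c := by positivity
  have hexp : Real.exp (-c) < 1 := by simpa using Real.exp_lt_exp.2 (show -c < 0 by linarith)
  have hsub : 0 < 1 - Real.exp (-c) := by linarith
  set L : ℝ := (G + 1) * Real.exp c + c * M / (1 - Real.exp (-c)) with hL
  have hL1 : (G + 1) * Real.exp c ≤ L := by
    have : 0 ≤ c * M / (1 - Real.exp (-c)) := by positivity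
    linarith
  have hL0 : 0 < L := lt_of_lt_of_le (by positivity) hL1
  have hLM : M ≤ L / c * (1 - Real.exp (-c)) := by
    have h1 : c * M / (1 - Real.exp (-c)) ≤ L := by
      have : 0 ≤ (G + 1) * Real.exp c := by positivity
      linarith
    rw [div_le_iff₀ hsub] at h1
    rw [div_mul_eq_mul_div, le_div_iff₀ hc0]
    linarith
  have hlin : ∀ d : ℝ, L / c * (1 - Real.exp (-c * d)) ≤ L * d := by
    intro d
    have h1 := Real.add_one_le_exp (-c * d)
    calc L / c * (1 - Real.exp (-c * d)) ≤ L / c * (c * d) := by gcongr; linarith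
      _ = L * d := by field_simp
  refine ⟨L, hL0.le, fun Q hQ hQ0 hQM hsj x y hyx => ?_⟩
  rcases le_or_gt x (y + 1) with hx | hx
  · have h1 : ∀ z, HasDerivAt (fun z => Q y + L / c * (1 - Real.exp (-c * (z - y))))
        (L * Real.exp (-c * (z - y))) z := by
      intro z
      have := ((((((hasDerivAt_id z).sub_const y).const_mul (-c)).exp).const_sub 1).const_mul
        (L / c)).const_add (Q y)
      convert! this using 1
      simp only [id]
      field_simp
    have h2 : ∀ z, HasDerivAt (fun z => L * Real.exp (-c * (z - y)))
        (-c * (L * Real.exp (-c * (z - y)))) z := by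
      intro z
      have := ((((hasDerivAt_id z).sub_const y).const_mul (-c)).exp).const_mul L
      convert! this using 1
      simp only [id]
      ring
    have := le_of_isSubjet (l := y) (u := y + 1) hQ h1 h2 (by simp)
      (by
        have : -c * (y + 1 - y) = -c := by ring
        rw [this]
        linarith [hQM (y + 1), hQ0 y]) ?_ x ⟨hyx, hx⟩
    · linarith [hlin (x - y)]
    · intro z hz
      obtain ⟨a, b, hab, hb⟩ := hsj z
      refine ⟨a, b, hab, fun ha => ?_⟩
      have hpos : 0 < L * Real.exp (-c * (z - y)) := by positivity
      rw [ha, abs_of_pos hpos] at hb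
      have hge : G + 1 ≤ L * Real.exp (-c * (z - y)) := by
        calc G + 1 = (G + 1) * Real.exp c * Real.exp (-c) := by
              rw [mul_assoc, ← Real.exp_add]; simp
          _ ≤ L * Real.exp (-c * (z - y)) := by
              gcongr
              nlinarith [hz.2]
      rw [hc] at hge hb ⊢
      linarith
  · have h1 := hlin 1
    simp only [mul_one] at h1
    nlinarith [hQM x, hQ0 y]

lemma exists_lipschitz {F G M : ℝ} (hF : 0 ≤ F) (hG : 0 ≤ G) (hM : 0 ≤ M) {Q : ℝ → ℝ}
    (hQ : Continuous Q) (hQ0 : ∀ x, 0 ≤ Q x) (hQM : ∀ x, Q x ≤ M)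
    (hsj : ∀ x, ∃ a b, IsSubjet Q x a b ∧ -G ≤ b + F * |a|) :
    ∃ L : NNReal, LipschitzWith L Q := by
  obtain ⟨L, hL0, hL⟩ := exists_growth_bound hF hG hM
  have h1 := hL Q hQ hQ0 hQM hsj
  have h2 := hL (fun z => Q (-z)) (hQ.comp continuous_neg) (fun x => hQ0 _) (fun x => hQM _) (by
    intro x
    obtain ⟨a, b, hab, hb⟩ := hsj (-x)
    exact ⟨-a, b, hab.comp_neg, by rwa [abs_neg]⟩)
  refine ⟨L.toNNReal, LipschitzWith.of_le_add_mul' L fun x y => ?_⟩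
  rw [Real.dist_eq]
  rcases le_total y x with h | h
  · rw [abs_of_nonneg (by linarith)]
    exact h1 x y h
  · rw [abs_of_nonpos (by linarith)]
    have := h2 (-x) (-y) (by linarith)
    simp only [neg_neg] at this
    linarith

lemma IsSubjet.abs_le_of_lipschitzWith {Q : ℝ → ℝ} {x a b : ℝ} {L : NNReal}
    (h : IsSubjet Q x a b) (hQ : LipschitzWith L Q) : |a| ≤ L := by
  have hev := h (b - 1) (by linarith)
  have key : ∀ s : ℝ, |s| = 1 → a * s ≤ L := by
    intro s hs
    have ht : Tendsto (fun k : ℝ => x + s * k) (𝓝[>] 0) (𝓝 x) := by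
      have : Continuous fun k : ℝ => x + s * k := by fun_prop
      have := this.tendsto 0
      simp only [mul_zero, add_zero] at this
      exact this.mono_left nhdsWithin_le_nhds
    have hlim : Tendsto (fun k : ℝ => a * s + (b - 1) / 2 * s ^ 2 * k) (𝓝[>] 0) (𝓝 (a * s)) := by
      have : Continuous fun k : ℝ => a * s + (b - 1) / 2 * s ^ 2 * k := by fun_prop
      have := this.tendsto 0
      simp only [mul_zero, add_zero] at this
      exact this.mono_left nhdsWithin_le_nhds
    refine le_of_tendsto hlim ?_
    filter_upwards [ht.eventually hev, self_mem_nhdsWithin] with k hk (hk0 : 0 < k)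
    have h1 := hQ.dist_le_mul (x + s * k) x
    rw [Real.dist_eq, Real.dist_eq] at h1
    have h2 := le_abs_self (Q (x + s * k) - Q x)
    have h3 : |x + s * k - x| = k := by
      rw [add_sub_cancel_left, abs_mul, hs, one_mul, abs_of_pos hk0]
    rw [h3] at h1
    have h4 : (a * s + (b - 1) / 2 * s ^ 2 * k) * k ≤ L * k := by
      nlinarith
    exact le_of_mul_le_mul_right h4 hk0
  rw [abs_le']
  constructor
  · simpa using key 1 (by simp)
  · simpa using key (-1) (by simp)

/-- Semiconvexity from a lower bound on the curvature of subjets. -/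
lemma neg_mul_sq_le_second_difference {Q : ℝ → ℝ} {K : ℝ} (hQ : Continuous Q)
    (hsj : ∀ x, ∃ a b, IsSubjet Q x a b ∧ -K < b) (x : ℝ) {k : ℝ} (hk : 0 < k) :
    -(K * k ^ 2) ≤ Q (x + k) + Q (x - k) - 2 * Q x := by
  set m := (Q (x + k) - Q (x - k)) / (2 * k) with hm
  set c := (Q (x + k) + Q (x - k)) / 2 with hc
  have hmk : m * k = (Q (x + k) - Q (x - k)) / 2 := by rw [hm]; field_simp
  have h1 : ∀ z, HasDerivAt (fun z => c + m * (z - x) + K / 2 * (k ^ 2 - (z - x) ^ 2))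
      (m - K * (z - x)) z := by
    intro z
    have h3 := (hasDerivAt_id z).sub_const x
    have := ((h3.const_mul m).const_add c).add (((h3.pow 2).const_sub (k ^ 2)).const_mul (K / 2))
    convert! this using 1
    simp only [id]; ring
  have h2 : ∀ z, HasDerivAt (fun z => m - K * (z - x)) (-K) z := by
    intro z
    have := (((hasDerivAt_id z).sub_const x).const_mul K).const_sub m
    convert! this using 1
    ring
  have := le_of_isSubjet (l := x - k) (u := x + k) hQ h1 h2 (by nlinarith) (by nlinarith)
    (fun z _ => by
      obtain ⟨a, b, hab, hb⟩ := hsj z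
      exact ⟨a, b, hab, fun _ => hb⟩) x ⟨by linarith, by linarith⟩
  simp only [sub_self, mul_zero, add_zero] at this
  nlinarith

lemma IsSubjet.eventually_second_difference {Q : ℝ → ℝ} {x a b b' : ℝ} (h : IsSubjet Q x a b)
    (hb : b' < b) :
    ∀ᶠ k in 𝓝[>] (0 : ℝ), b' * k ^ 2 ≤ Q (x + k) + Q (x - k) - 2 * Q x := by
  have ht1 : Tendsto (fun k : ℝ => x + k) (𝓝[>] 0) (𝓝 x) := by
    have : Continuous fun k : ℝ => x + k := by fun_prop
    have := this.tendsto 0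
    simp only [add_zero] at this
    exact this.mono_left nhdsWithin_le_nhds
  have ht2 : Tendsto (fun k : ℝ => x - k) (𝓝[>] 0) (𝓝 x) := by
    have : Continuous fun k : ℝ => x - k := by fun_prop
    have := this.tendsto 0
    simp only [sub_zero] at this
    exact this.mono_left nhdsWithin_le_nhds
  filter_upwards [ht1.eventually (h b' hb), ht2.eventually (h b' hb)] with k h1 h2
  nlinarith

lemma IsSubjet.eq_of_hasDerivAt {Q : ℝ → ℝ} {x a b q : ℝ} (h : IsSubjet Q x a b)
    (hq : HasDerivAt Q q x) : a = q := by
  have hd : HasDerivAt (fun z => Q z - (Q x + a * (z - x) + (b - 1) / 2 * (z - x) ^ 2))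
      (q - a) x := by
    have h3 := (hasDerivAt_id x).sub_const x
    have := hq.sub (((h3.const_mul a).const_add (Q x)).add ((h3.pow 2).const_mul ((b - 1) / 2)))
    convert! this using 1
    simp
  have hmin : IsLocalMin (fun z => Q z - (Q x + a * (z - x) + (b - 1) / 2 * (z - x) ^ 2)) x := by
    filter_upwards [h (b - 1) (by linarith)] with z hz
    simp only [sub_self, mul_zero, ne_eq, OfNat.ofNat_ne_zero, not_false_eq_true, zero_pow,
      add_zero]
    linarith
  linarith [hmin.hasDerivAt_eq_zero hd]

lemma integral_second_difference_eq_zero {Q : ℝ → ℝ} (hQ : Continuous Q)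
    (hcs : HasCompactSupport Q) (h : ℝ) :
    Integrable (fun x => Q x * (Q (x + h) + Q (x - h) - 2 * Q x) + (Q (x + h) - Q x) ^ 2) ∧
    ∫ x, (Q x * (Q (x + h) + Q (x - h) - 2 * Q x) + (Q (x + h) - Q x) ^ 2) = 0 := by
  set T : ℝ → ℝ := fun x => Q x * (Q x - Q (x - h)) with hT
  have hTi : Integrable T := by
    apply Continuous.integrable_of_hasCompactSupport (by fun_prop)
    exact hcs.mul_right
  have hTi' : Integrable (fun x => T (x + h)) := hTi.comp_add_right h
  have e : (fun x => Q x * (Q (x + h) + Q (x - h) - 2 * Q x) + (Q (x + h) - Q x) ^ 2)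
      = fun x => T (x + h) - T x := by
    funext x
    simp only [hT, add_sub_cancel_right]
    ring
  rw [e]
  refine ⟨hTi'.sub hTi, ?_⟩
  rw [integral_sub hTi' hTi, integral_add_right_eq_self T h, sub_self]

lemma eventually_neg_le_integral_mul {F G C M : ℝ} (hF : 0 ≤ F) (hG : 0 ≤ G) (hC : 0 ≤ C)
    (hM : 0 ≤ M) {Q : ℝ → ℝ} (hQ : Continuous Q) (hQ0 : ∀ x, 0 ≤ Q x) (hQM : ∀ x, Q x ≤ M)
    (hsupp : ∀ x ∉ Ioo (0 : ℝ) 1, Q x = 0) {N : ℝ → ℝ → ℝ} (hN : ∀ h, Continuous (N h))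
    (H : ∀ x, 0 < Q x → ∃ a b g, IsSubjet Q x a b ∧ -g ≤ b + F * |a| ∧ |g| ≤ G ∧
      ∀ h > 0, g - C * h ≤ N h x) {η : ℝ} (hη : 0 < η) :
    ∀ᶠ h in 𝓝[>] (0 : ℝ), -(F ^ 2 / 4) * (∫ x, Q x ^ 2) - η ≤ ∫ x, Q x * N h x := by
  have hcs : HasCompactSupport Q := HasCompactSupport.intro (K := Icc (0 : ℝ) 1) isCompact_Icc
    fun x hx => hsupp x fun h => hx (Ioo_subset_Icc_self h)
  have hint : ∀ f : ℝ → ℝ, Continuous f → Integrable (fun x => Q x * f x) := fun f hf =>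
    (hQ.mul hf).integrable_of_hasCompactSupport hcs.mul_right
  have hsj : ∀ x, ∃ a b, IsSubjet Q x a b ∧ -G ≤ b + F * |a| := by
    intro x
    rcases eq_or_lt_of_le (hQ0 x) with h0 | h0
    · exact ⟨0, 0, isSubjet_zero hQ0 h0.symm, by simpa using hG⟩
    · obtain ⟨a, b, g, h1, h2, h3, -⟩ := H x h0
      exact ⟨a, b, h1, by linarith [le_abs_self g]⟩
  obtain ⟨L, hL⟩ := exists_lipschitz hF hG hM hQ hQ0 hQM hsj
  set K : ℝ := G + F * L + 1 with hK
  have hK0 : 0 ≤ K := by positivity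
  have hsemi : ∀ x k : ℝ, 0 < k → -(K * k ^ 2) ≤ Q (x + k) + Q (x - k) - 2 * Q x := by
    intro x k hk
    refine neg_mul_sq_le_second_difference hQ (fun x => ?_) x hk
    obtain ⟨a, b, h1, h2⟩ := hsj x
    refine ⟨a, b, h1, ?_⟩
    have := mul_le_mul_of_nonneg_left (h1.abs_le_of_lipschitzWith hL) hF
    linarith
  set J : ℝ → ℝ → ℝ := fun h x => Q x * (-(N h x) - (Q (x + h) + Q (x - h) - 2 * Q x) / h ^ 2
    - F * (|Q (x + h) - Q x| / h)) with hJ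
  have hJc : ∀ h, Integrable (J h) := by
    intro h
    have := hN h
    apply hint
    fun_prop
  have hJle : ∀ h ∈ Ioo (0 : ℝ) 1, ∀ x, J h x ≤ Q x * (G + C + K) := by
    intro h hh x
    rcases eq_or_lt_of_le (hQ0 x) with h0 | h0
    · simp [hJ, ← h0]
    · obtain ⟨a, b, g, h1, h2, h3, h4⟩ := H x h0
      have h5 := h4 h hh.1
      have h6 : -K ≤ (Q (x + h) + Q (x - h) - 2 * Q x) / h ^ 2 := by
        rw [le_div_iff₀ (pow_pos hh.1 2)]
        linarith [hsemi x h hh.1]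
      have h7 : 0 ≤ F * (|Q (x + h) - Q x| / h) := by have := hh.1; positivity
      have h8 : C * h ≤ C := by nlinarith [hh.2]
      apply mul_le_mul_of_nonneg_left _ h0.le
      linarith [neg_abs_le g]
  have hlim : ∀ᵐ x, Tendsto (fun h => max (J h x) 0) (𝓝[>] 0) (𝓝 0) := by
    filter_upwards [hL.ae_differentiableAt_real] with x hx
    rcases eq_or_lt_of_le (hQ0 x) with h0 | h0
    · simp [hJ, ← h0]
    obtain ⟨a, b, g, h1, h2, h3, h4⟩ := H x h0
    have ha : a = deriv Q x := h1.eq_of_hasDerivAt hx.hasDerivAt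
    have hD : Tendsto (fun h => |Q (x + h) - Q x| / h) (𝓝[>] 0) (𝓝 |a|) := by
      have := (hasDerivAt_iff_tendsto_slope_zero.1 hx.hasDerivAt).mono_left
        (nhdsGT_le_nhdsNE (0 : ℝ))
      rw [← ha] at this
      refine this.abs.congr' ?_
      filter_upwards [self_mem_nhdsWithin] with h (hh : 0 < h)
      rw [smul_eq_mul, abs_mul, abs_inv, abs_of_pos hh]
      field_simp
    rw [Metric.tendsto_nhds]
    intro η hη
    set δ := η / (4 * Q x) with hδ
    have hδ0 : 0 < δ := by positivity
    have hF1 : Tendsto (fun h => F * (|Q (x + h) - Q x| / h)) (𝓝[>] 0) (𝓝 (F * |a|)) :=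
      hD.const_mul F
    have hC1 : Tendsto (fun h => C * h) (𝓝[>] 0) (𝓝 0) := by
      have : Continuous fun h : ℝ => C * h := by fun_prop
      have := this.tendsto 0
      simp only [mul_zero] at this
      exact this.mono_left nhdsWithin_le_nhds
    filter_upwards [hF1.eventually_const_lt (show F * |a| - δ < F * |a| by linarith),
      hC1.eventually_lt_const hδ0,
      h1.eventually_second_difference (show b - δ < b by linarith), self_mem_nhdsWithin]
      with h e1 e2 e3 (hh : 0 < h)
    have e4 := h4 h hh
    have e5 : b - δ ≤ (Q (x + h) + Q (x - h) - 2 * Q x) / h ^ 2 := by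
      rwa [le_div_iff₀ (pow_pos hh 2)]
    have e6 : J h x ≤ Q x * (3 * δ) := by
      apply mul_le_mul_of_nonneg_left _ h0.le
      linarith
    have e7 : Q x * (3 * δ) < η := by
      rw [hδ]; field_simp; linarith
    rw [Real.dist_eq, sub_zero, abs_of_nonneg (le_max_right _ _)]
    exact max_lt (by linarith) hη
  have hmain : Tendsto (fun h => ∫ x, max (J h x) 0) (𝓝[>] 0) (𝓝 (∫ _ : ℝ, (0 : ℝ))) := by
    refine tendsto_integral_filter_of_dominated_convergence (fun x => Q x * (G + C + K)) ?_ ?_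
      (hint _ continuous_const) hlim
    · exact Eventually.of_forall fun h => (hJc h).pos_part.aestronglyMeasurable
    · filter_upwards [Ioo_mem_nhdsGT (zero_lt_one (α := ℝ))] with h hh
      refine Eventually.of_forall fun x => ?_
      rw [Real.norm_eq_abs, abs_of_nonneg (le_max_right _ _)]
      exact max_le (hJle h hh x) (mul_nonneg (hQ0 x) (by positivity))
  rw [integral_zero] at hmain
  filter_upwards [hmain.eventually_lt_const hη, self_mem_nhdsWithin] with h hh (hpos : 0 < h)
  obtain ⟨hSi, hS⟩ := integral_second_difference_eq_zero hQ hcs h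
  have i1 : Integrable fun x => Q x * N h x := hint _ (hN h)
  have i2 : Integrable fun x => F ^ 2 / 4 * Q x ^ 2 := by
    have := hint (fun x => F ^ 2 / 4 * Q x) (by fun_prop)
    refine this.congr (Eventually.of_forall fun x => ?_)
    ring
  have i3 := (hJc h).pos_part
  have hle := integral_mono (hSi.const_mul (-(1 / h ^ 2))) ((i1.add i2).add i3) (fun x => by
    change -(1 / h ^ 2) * _ ≤ Q x * N h x + F ^ 2 / 4 * Q x ^ 2 + max (J h x) 0
    refine le_trans ?_ (add_le_add_right (le_max_left (J h x) 0) _)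
    have e1 : ((Q (x + h) - Q x) ^ 2) = |Q (x + h) - Q x| ^ 2 := (sq_abs _).symm
    rw [e1]
    have e2 := sq_nonneg (F / 2 * Q x - |Q (x + h) - Q x| / h)
    have e3 : Q x * N h x + F ^ 2 / 4 * Q x ^ 2 + J h x
        - (-(1 / h ^ 2) * (Q x * (Q (x + h) + Q (x - h) - 2 * Q x) + |Q (x + h) - Q x| ^ 2))
        = (F / 2 * Q x - |Q (x + h) - Q x| / h) ^ 2 := by
      simp only [hJ]
      field_simp
      ring
    linarith)
  rw [MeasureTheory.integral_const_mul, hS, mul_zero, integral_add' (i1.add i2) i3,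
    integral_add' i1 i2, MeasureTheory.integral_const_mul] at hle
  linarith

/-- Sup-convolution in the time variable over `[0, τ]`. -/
noncomputable def timeSupConv (w : ℝ → ℝ → ℝ) (τ ε x t : ℝ) : ℝ :=
  sSup ((fun s => w x s - (t - s) ^ 2 / (2 * ε)) '' Icc 0 τ)

section timeSupConv

variable {w : ℝ → ℝ → ℝ} {τ ε : ℝ}

lemma continuous_timeSupConv (hw : Continuous fun z : ℝ × ℝ => w z.1 z.2) :
    Continuous fun z : ℝ × ℝ => timeSupConv w τ ε z.1 z.2 := by
  refine isCompact_Icc.continuous_sSup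
    (f := fun (z : ℝ × ℝ) s => w z.1 s - (z.2 - s) ^ 2 / (2 * ε)) ?_
  have h1 : Continuous fun z : (ℝ × ℝ) × ℝ => w z.1.1 z.2 :=
    hw.comp (f := fun z : (ℝ × ℝ) × ℝ => (z.1.1, z.2)) (by fun_prop)
  change Continuous fun z : (ℝ × ℝ) × ℝ => w z.1.1 z.2 - (z.1.2 - z.2) ^ 2 / (2 * ε)
  fun_prop

lemma continuousOn_penalized (hw : Continuous fun z : ℝ × ℝ => w z.1 z.2) (x t : ℝ) :
    ContinuousOn (fun s => w x s - (t - s) ^ 2 / (2 * ε)) (Icc 0 τ) := by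
  have h1 : Continuous fun s => w x s := hw.comp (f := fun s : ℝ => (x, s)) (by fun_prop)
  exact Continuous.continuousOn (by fun_prop)

lemma le_timeSupConv (hw : Continuous fun z : ℝ × ℝ => w z.1 z.2) (x t : ℝ) {s : ℝ}
    (hs : s ∈ Icc 0 τ) : w x s - (t - s) ^ 2 / (2 * ε) ≤ timeSupConv w τ ε x t :=
  le_csSup (isCompact_Icc.bddAbove_image (continuousOn_penalized hw x t)) ⟨s, hs, rfl⟩

lemma self_le_timeSupConv (hw : Continuous fun z : ℝ × ℝ => w z.1 z.2) (x : ℝ) {t : ℝ}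
    (ht : t ∈ Icc 0 τ) : w x t ≤ timeSupConv w τ ε x t := by
  simpa using le_timeSupConv (ε := ε) hw x t ht

lemma exists_timeSupConv_eq (hw : Continuous fun z : ℝ × ℝ => w z.1 z.2) (hτ : 0 ≤ τ) (x t : ℝ) :
    ∃ s ∈ Icc 0 τ, timeSupConv w τ ε x t = w x s - (t - s) ^ 2 / (2 * ε) :=
  isCompact_Icc.exists_sSup_image_eq ⟨0, left_mem_Icc.2 hτ⟩ (continuousOn_penalized hw x t)

lemma timeSupConv_le {M : ℝ} (hw : Continuous fun z : ℝ × ℝ => w z.1 z.2) (hτ : 0 ≤ τ)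
    (hε : 0 < ε) (hwM : ∀ x s, w x s ≤ M) (x t : ℝ) : timeSupConv w τ ε x t ≤ M := by
  obtain ⟨s, -, e⟩ := exists_timeSupConv_eq (ε := ε) hw hτ x t
  have : 0 ≤ (t - s) ^ 2 / (2 * ε) := by positivity
  linarith [hwM x s]

lemma tendsto_timeSupConv {M : ℝ} (hw : Continuous fun z : ℝ × ℝ => w z.1 z.2) (hτ : 0 ≤ τ)
    (hw0 : ∀ x s, 0 ≤ w x s) (hwM : ∀ x s, w x s ≤ M) (x : ℝ) {t : ℝ} (ht : t ∈ Icc 0 τ) :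
    Tendsto (fun ε => timeSupConv w τ ε x t) (𝓝[>] 0) (𝓝 (w x t)) := by
  have h1 : Continuous fun s => w x s := hw.comp (f := fun s : ℝ => (x, s)) (by fun_prop)
  rw [Metric.tendsto_nhds]
  intro η hη
  obtain ⟨δ, hδ, hδw⟩ := Metric.continuous_iff.1 h1 t η hη
  have hev : ∀ᶠ ε in 𝓝[>] (0 : ℝ), 2 * ε * M < δ ^ 2 := by
    have : Continuous fun ε : ℝ => 2 * ε * M := by fun_prop
    have := this.tendsto 0
    simp only [mul_zero, zero_mul] at this
    exact (this.mono_left nhdsWithin_le_nhds).eventually_lt_const (by positivity)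
  filter_upwards [hev, self_mem_nhdsWithin] with ε hεM (hε : 0 < ε)
  have hle := self_le_timeSupConv (ε := ε) hw x ht
  obtain ⟨s, hs, e⟩ := exists_timeSupConv_eq (ε := ε) hw hτ x t
  rw [Real.dist_eq, abs_of_nonneg (by linarith)]
  rcases lt_or_ge (dist s t) δ with hst | hst
  · have h2 := hδw s hst
    rw [Real.dist_eq] at h2
    have : 0 ≤ (t - s) ^ 2 / (2 * ε) := by positivity
    linarith [le_abs_self (w x s - w x t)]
  · rw [Real.dist_eq, abs_sub_comm] at hst
    have h3 : δ ^ 2 ≤ (t - s) ^ 2 := by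
      rw [← sq_abs (t - s)]
      gcongr
    have h4 : M < (t - s) ^ 2 / (2 * ε) := by
      rw [lt_div_iff₀ (by positivity)]
      linarith
    linarith [hwM x s, hw0 x t]

lemma integral_sq_timeSupConv_le {F M T : ℝ} (hF : 0 ≤ F) (hM : 0 ≤ M)
    (hw : Continuous fun z : ℝ × ℝ => w z.1 z.2) (hw0 : ∀ x s, 0 ≤ w x s)
    (hwM : ∀ x s, w x s ≤ M) (hsupp : ∀ x ∉ Ioo (0 : ℝ) 1, ∀ s, w x s = 0)
    (H : ∀ x, ∀ s ∈ Ico 0 τ, 0 < w x s → ∃ v a b, HasDerivWithinAt (w x) v (Ioi s) s ∧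
      IsSubjet (fun z => w z s) x a b ∧ -v ≤ b + F * |a|)
    (hε : 0 < ε) (hTτ : T < τ) (hεM : 2 * ε * M < (τ - T) ^ 2) {t : ℝ} (ht : t ∈ Icc 0 T) :
    ∫ x in (0 : ℝ)..1, timeSupConv w τ ε x t ^ 2 ≤
      (∫ x in (0 : ℝ)..1, timeSupConv w τ ε x T ^ 2) * Real.exp (F ^ 2 / 2 * (T - t)) := by
  set q : ℝ → ℝ → ℝ := timeSupConv w τ ε with hq
  have hτ : 0 ≤ τ := ht.1.trans (ht.2.trans hTτ.le)
  have hqc : Continuous fun z : ℝ × ℝ => q z.1 z.2 := continuous_timeSupConv hw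
  have hqx : ∀ t, Continuous fun x => q x t := fun t =>
    hqc.comp (f := fun x : ℝ => (x, t)) (by fun_prop)
  have hEc : Continuous fun t => ∫ x in (0 : ℝ)..1, q x t ^ 2 := by
    apply intervalIntegral.continuous_parametric_intervalIntegral_of_continuous'
    exact (hqc.comp continuous_swap).pow 2
  have hderiv : ∀ t ∈ Ico 0 T, ∀ η > 0, ∀ᶠ h in 𝓝[>] (0 : ℝ),
      -(F ^ 2 / 4) * (∫ x in (0 : ℝ)..1, q x t ^ 2) - η ≤
        ∫ x in (0 : ℝ)..1, q x t * ((q x (t + h) - q x t) / h) := by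
    intro t ht η hη
    have htτ : t ∈ Icc 0 τ := ⟨ht.1, ht.2.le.trans hTτ.le⟩
    have hQ0 : ∀ x, 0 ≤ q x t := fun x => (hw0 x t).trans (self_le_timeSupConv hw x htτ)
    have hQs : ∀ x ∉ Ioo (0 : ℝ) 1, q x t = 0 := by
      intro x hx
      refine le_antisymm ?_ (hQ0 x)
      obtain ⟨s, -, e⟩ := exists_timeSupConv_eq (ε := ε) hw hτ x t
      have : 0 ≤ (t - s) ^ 2 / (2 * ε) := by positivity
      rw [hq, e, hsupp x hx]
      linarith
    have hcon : ∀ f : ℝ → ℝ, ∫ x, q x t * f x = ∫ x in (0 : ℝ)..1, q x t * f x := by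
      intro f
      refine (intervalIntegral.integral_eq_integral_of_support_subset fun x hx => ?_).symm
      by_contra hx'
      exact hx (mul_eq_zero_of_left (hQs x fun h => hx' (Ioo_subset_Ioc_self h)) _)
    have key := eventually_neg_le_integral_mul (G := τ / ε) (C := 1 / (2 * ε)) hF (by positivity)
      (by positivity) hM (hqx t) hQ0 (fun x => timeSupConv_le hw hτ hε hwM x t) hQs
      (N := fun h x => (q x (t + h) - q x t) / h)
      (fun h => by have := hqx (t + h); have := hqx t; fun_prop) ?_ hη
    · have e2 : ∫ x, q x t ^ 2 = ∫ x in (0 : ℝ)..1, q x t ^ 2 := by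
        simpa only [sq] using hcon fun x => q x t
      filter_upwards [key] with h hh
      rwa [hcon, e2] at hh
    intro x hx
    obtain ⟨s, hs, e⟩ := exists_timeSupConv_eq (ε := ε) hw hτ x t
    have hpen : 0 ≤ (t - s) ^ 2 / (2 * ε) := by positivity
    have hws : 0 < w x s := by
      have : q x t = w x s - (t - s) ^ 2 / (2 * ε) := e
      linarith
    have hsτ : s < τ := by
      refine lt_of_le_of_ne hs.2 fun hsτ => ?_
      have h1 : (τ - T) ^ 2 ≤ (t - s) ^ 2 := by rw [hsτ]; nlinarith [ht.2]
      have h2 : M < (t - s) ^ 2 / (2 * ε) := by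
        rw [lt_div_iff₀ (by positivity)]
        linarith
      have : q x t = w x s - (t - s) ^ 2 / (2 * ε) := e
      linarith [hwM x s]
    obtain ⟨v, a, b, hv, hab, hvab⟩ := H x s ⟨hs.1, hsτ⟩ hws
    have hvg : v ≤ (s - t) / ε := by
      have hd : HasDerivWithinAt (fun r => w x r - (t - r) ^ 2 / (2 * ε)) (v - (s - t) / ε)
          (Ioi s) s := by
        have h1 := ((((hasDerivAt_id s).const_sub t).pow 2).div_const (2 * ε)).hasDerivWithinAt
          (s := Ioi s)
        convert! hv.sub h1 using 1
        simp only [id]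
        field_simp
        ring
      rw [hasDerivWithinAt_iff_tendsto_slope' (by simp)] at hd
      have : v - (s - t) / ε ≤ 0 := by
        refine le_of_tendsto hd ?_
        filter_upwards [Ioo_mem_nhdsGT hsτ] with r hr
        have h2 := le_timeSupConv (ε := ε) hw x t (s := r) ⟨hs.1.trans hr.1.le, hr.2.le⟩
        rw [slope_def_field]
        apply div_nonpos_of_nonpos_of_nonneg <;> linarith [hr.1]
      linarith
    refine ⟨a, b, (s - t) / ε, hab.of_eventually_le (Eventually.of_forall fun z => ?_),
      by linarith, ?_, fun h hh => ?_⟩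
    · have := le_timeSupConv (ε := ε) hw z t hs
      rw [hq, e]
      linarith
    · rw [abs_div, abs_of_pos hε]
      gcongr
      rw [abs_le]
      constructor <;> linarith [hs.1, hs.2, htτ.1, htτ.2]
    · have h2 := le_timeSupConv (ε := ε) hw x (t + h) hs
      rw [le_div_iff₀ hh, hq, e]
      have : ((s - t) / ε - 1 / (2 * ε) * h) * h
          = (t - s) ^ 2 / (2 * ε) - (t + h - s) ^ 2 / (2 * ε) := by
        field_simp
        ring
      linarith
  have hgron := le_gronwallBound_of_liminf_deriv_right_le (a := t) (b := T)
    (f := fun t => -∫ x in (0 : ℝ)..1, q x t ^ 2)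
    (f' := fun t => F ^ 2 / 2 * ∫ x in (0 : ℝ)..1, q x t ^ 2)
    (δ := -∫ x in (0 : ℝ)..1, q x t ^ 2) (K := -(F ^ 2 / 2)) (ε := 0) hEc.neg.continuousOn ?_
    le_rfl (fun x _ => by linarith) T ⟨ht.2, le_rfl⟩
  · rw [gronwallBound_ε0] at hgron
    have h1 : (∫ x in (0 : ℝ)..1, q x t ^ 2) * Real.exp (-(F ^ 2 / 2) * (T - t)) ≤
        ∫ x in (0 : ℝ)..1, q x T ^ 2 := by linarith
    calc ∫ x in (0 : ℝ)..1, q x t ^ 2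
        = (∫ x in (0 : ℝ)..1, q x t ^ 2) * Real.exp (-(F ^ 2 / 2) * (T - t))
          * Real.exp (F ^ 2 / 2 * (T - t)) := by
          rw [mul_assoc, ← Real.exp_add]
          simp
      _ ≤ _ := by gcongr
  · intro s hs r hr
    apply Eventually.frequently
    have hT : Tendsto (fun z => z - s) (𝓝[>] s) (𝓝[>] 0) := by
      refine tendsto_nhdsWithin_iff.2 ⟨?_, ?_⟩
      · have : Continuous fun z : ℝ => z - s := by fun_prop
        have := this.tendsto s
        rw [sub_self] at this
        exact this.mono_left nhdsWithin_le_nhds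
      · filter_upwards [self_mem_nhdsWithin] with z (hz : s < z)
        exact sub_pos.2 hz
    set E := ∫ x in (0 : ℝ)..1, q x s ^ 2 with hE
    have hη : 0 < (r - F ^ 2 / 2 * E) / 4 := by linarith
    filter_upwards [hT.eventually (hderiv s ⟨ht.1.trans hs.1, hs.2⟩ _ hη), self_mem_nhdsWithin]
      with z hz (hsz : s < z)
    rw [add_sub_cancel, ← hE] at hz
    have hpos : 0 < z - s := sub_pos.2 hsz
    have c1 := hqx s
    have c2 := hqx z
    have hmono : ∫ x in (0 : ℝ)..1, (2 * (z - s)) * (q x s * ((q x z - q x s) / (z - s))) ≤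
        ∫ x in (0 : ℝ)..1, (q x z ^ 2 - q x s ^ 2) := by
      refine intervalIntegral.integral_mono_on zero_le_one
        (Continuous.intervalIntegrable (by fun_prop) _ _)
        (Continuous.intervalIntegrable (by fun_prop) _ _) fun x _ => ?_
      have : (2 * (z - s)) * (q x s * ((q x z - q x s) / (z - s)))
          = 2 * q x s * (q x z - q x s) := by field_simp
      rw [this]
      nlinarith [sq_nonneg (q x z - q x s)]
    rw [intervalIntegral.integral_const_mul, intervalIntegral.integral_sub
      (Continuous.intervalIntegrable (by fun_prop) _ _)
      (Continuous.intervalIntegrable (by fun_prop) _ _), ← hE] at hmono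
    rw [inv_mul_lt_iff₀ hpos]
    nlinarith

/-- The energy estimate for nonnegative viscosity-type subsolutions. -/
lemma integral_sq_le_of_subsolution {F M : ℝ} (hF : 0 ≤ F) (hM : 0 ≤ M)
    (hw : Continuous fun z : ℝ × ℝ => w z.1 z.2) (hw0 : ∀ x s, 0 ≤ w x s)
    (hwM : ∀ x s, w x s ≤ M) (hsupp : ∀ x ∉ Ioo (0 : ℝ) 1, ∀ s, w x s = 0)
    (H : ∀ x, ∀ s ∈ Ico 0 τ, 0 < w x s → ∃ v a b, HasDerivWithinAt (w x) v (Ioi s) s ∧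
      IsSubjet (fun z => w z s) x a b ∧ -v ≤ b + F * |a|) {t : ℝ} (ht : t ∈ Icc 0 τ) :
    ∫ x in (0 : ℝ)..1, w x t ^ 2 ≤
      (∫ x in (0 : ℝ)..1, w x τ ^ 2) * Real.exp (F ^ 2 / 2 * (τ - t)) := by
  rcases eq_or_lt_of_le ht.2 with rfl | htτ
  · simp
  have hτ : 0 ≤ τ := ht.1.trans ht.2
  have hlim : ∀ s ∈ Icc 0 τ, Tendsto (fun ε => ∫ x in (0 : ℝ)..1, timeSupConv w τ ε x s ^ 2)
      (𝓝[>] 0) (𝓝 (∫ x in (0 : ℝ)..1, w x s ^ 2)) := by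
    intro s hs
    refine intervalIntegral.tendsto_integral_filter_of_dominated_convergence (fun _ => M ^ 2)
      ?_ ?_ intervalIntegrable_const ?_
    · refine Eventually.of_forall fun ε => Continuous.aestronglyMeasurable ?_
      exact ((continuous_timeSupConv hw).comp (f := fun x : ℝ => (x, s)) (by fun_prop)).pow 2
    · filter_upwards [self_mem_nhdsWithin] with ε (hε : 0 < ε)
      refine Eventually.of_forall fun x _ => ?_
      have h1 := (hw0 x s).trans (self_le_timeSupConv (ε := ε) hw x hs)
      rw [Real.norm_eq_abs, abs_of_nonneg (by positivity)]
      gcongr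
      exact timeSupConv_le hw hτ hε hwM x s
    · exact Eventually.of_forall fun x _ => (tendsto_timeSupConv hw hτ hw0 hwM x hs).pow 2
  have hT : ∀ T ∈ Ioo t τ, ∫ x in (0 : ℝ)..1, w x t ^ 2 ≤
      (∫ x in (0 : ℝ)..1, w x T ^ 2) * Real.exp (F ^ 2 / 2 * (T - t)) := by
    intro T hT
    have hTτ : T ∈ Icc 0 τ := ⟨ht.1.trans hT.1.le, hT.2.le⟩
    refine le_of_tendsto_of_tendsto (hlim t ht) ((hlim T hTτ).mul_const _) ?_
    have hev : ∀ᶠ ε in 𝓝[>] (0 : ℝ), 2 * ε * M < (τ - T) ^ 2 := by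
      have : Continuous fun ε : ℝ => 2 * ε * M := by fun_prop
      have := this.tendsto 0
      simp only [mul_zero, zero_mul] at this
      exact (this.mono_left nhdsWithin_le_nhds).eventually_lt_const
        (pow_pos (sub_pos.2 hT.2) 2)
    filter_upwards [hev, self_mem_nhdsWithin] with ε hεM (hε : 0 < ε)
    exact integral_sq_timeSupConv_le hF hM hw hw0 hwM hsupp H hε hT.2 hεM ⟨ht.1, hT.1.le⟩
  have hc : Continuous fun T => (∫ x in (0 : ℝ)..1, w x T ^ 2)
      * Real.exp (F ^ 2 / 2 * (T - t)) := by
    have : Continuous fun t => ∫ x in (0 : ℝ)..1, w x t ^ 2 := by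
      apply intervalIntegral.continuous_parametric_intervalIntegral_of_continuous'
      exact (hw.comp continuous_swap).pow 2
    fun_prop
  refine ge_of_tendsto ((hc.tendsto τ).mono_left (nhdsWithin_le_nhds (s := Iio τ))) ?_
  filter_upwards [Ioo_mem_nhdsLT htτ] with T h using hT T h

end timeSupConv

lemma integral_sq_posPart_le {v : ℝ → ℝ → ℝ} {τ F : ℝ} (hF : 0 ≤ F)
    (hc : ContinuousOn (fun z : ℝ × ℝ => v z.1 z.2) (Icc 0 1 ×ˢ Icc 0 τ))
    (hb : ∀ s ∈ Icc 0 τ, v 0 s = 0 ∧ v 1 s = 0)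
    (H : ∀ x ∈ Ioo (0 : ℝ) 1, ∀ s ∈ Ico 0 τ, 0 < v x s → ∃ v' a b,
      HasDerivWithinAt (v x) v' (Icc 0 τ) s ∧ IsSubjet (fun z => v z s) x a b ∧
        -v' ≤ b + F * |a|) {t : ℝ} (ht : t ∈ Icc 0 τ) :
    ∫ x in (0 : ℝ)..1, max (v x t) 0 ^ 2 ≤
      (∫ x in (0 : ℝ)..1, max (v x τ) 0 ^ 2) * Real.exp (F ^ 2 / 2 * (τ - t)) := by
  have hτ : 0 ≤ τ := ht.1.trans ht.2
  obtain ⟨M, hM⟩ := (isCompact_Icc.prod isCompact_Icc).exists_bound_of_continuousOn hc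
  set w : ℝ → ℝ → ℝ := fun x s =>
    max (v (projIcc 0 1 zero_le_one x) (projIcc 0 τ hτ s)) 0 with hw
  have hwc : Continuous fun z : ℝ × ℝ => w z.1 z.2 := by
    refine Continuous.max (hc.comp_continuous (f := fun z : ℝ × ℝ =>
      ((projIcc (0 : ℝ) 1 zero_le_one z.1 : ℝ), (projIcc 0 τ hτ z.2 : ℝ))) ?_ ?_)
      continuous_const
    · have h1 := continuous_subtype_val.comp (continuous_projIcc (h := zero_le_one (α := ℝ)))
      have h2 := continuous_subtype_val.comp (continuous_projIcc (h := hτ))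
      exact (h1.comp continuous_fst).prodMk (h2.comp continuous_snd)
    · exact fun z => ⟨Subtype.coe_prop _, Subtype.coe_prop _⟩
  have hwv : ∀ x ∈ Icc (0 : ℝ) 1, ∀ s ∈ Icc 0 τ, w x s = max (v x s) 0 := by
    intro x hx s hs
    simp only [hw, projIcc_of_mem _ hx, projIcc_of_mem _ hs]
  have hM0 : 0 ≤ M := (norm_nonneg _).trans
    (hM (0, 0) ⟨left_mem_Icc.2 zero_le_one, left_mem_Icc.2 hτ⟩)
  have hsupp : ∀ x ∉ Ioo (0 : ℝ) 1, ∀ s, w x s = 0 := by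
    intro x hx s
    rcases le_or_gt x 0 with h0 | h0
    · simp [hw, projIcc_of_le_left _ h0, (hb _ (projIcc 0 τ hτ s).2).1]
    · have h1 : 1 ≤ x := le_of_not_gt fun h1 => hx ⟨h0, h1⟩
      simp [hw, projIcc_of_right_le _ h1, (hb _ (projIcc 0 τ hτ s).2).2]
  have key := integral_sq_le_of_subsolution (w := w) (τ := τ) hF hM0 hwc
    (fun x s => le_max_right _ _) (fun x s => ?_) hsupp ?_ ht
  · have e : ∀ s ∈ Icc 0 τ, ∫ x in (0 : ℝ)..1, w x s ^ 2
        = ∫ x in (0 : ℝ)..1, max (v x s) 0 ^ 2 := by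
      intro s hs
      refine intervalIntegral.integral_congr fun x hx => ?_
      rw [uIcc_of_le zero_le_one] at hx
      simp only [hwv x hx s hs]
    rwa [e t ht, e τ ⟨hτ, le_rfl⟩] at key
  · refine max_le ((le_abs_self _).trans ?_) hM0
    exact hM (_, _) ⟨Subtype.coe_prop _, Subtype.coe_prop _⟩
  · intro x s hs hws
    have hx : x ∈ Ioo (0 : ℝ) 1 := by
      by_contra hx
      exact hws.ne' (hsupp x hx s)
    have hs' : s ∈ Icc 0 τ := Ico_subset_Icc_self hs
    have hx' : x ∈ Icc (0 : ℝ) 1 := Ioo_subset_Icc_self hx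
    rw [hwv x hx' s hs'] at hws
    have hv : 0 < v x s := by simpa using hws
    obtain ⟨v', a, b, h1, h2, h3⟩ := H x hx s hs hv
    have hmem : Icc 0 τ ∈ 𝓝[>] s :=
      mem_of_superset (Ioo_mem_nhdsGT hs.2) fun r hr => ⟨hs.1.trans hr.1.le, hr.2.le⟩
    have h4 : HasDerivWithinAt (v x) v' (Ioi s) s := h1.mono_of_mem_nhdsWithin hmem
    refine ⟨v', a, b, h4.congr_of_eventuallyEq ?_ ?_, h2.of_eventually_le ?_, h3⟩
    · filter_upwards [h4.continuousWithinAt.eventually_const_lt hv, hmem] with r hr hr'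
      rw [hwv x hx' r hr', max_eq_left hr.le]
    · rw [hwv x hx' s hs', max_eq_left hv.le]
    · filter_upwards [Ioo_mem_nhds hx.1 hx.2] with z hz
      rw [hwv x hx' s hs', hwv z (Ioo_subset_Icc_self hz) s hs', max_eq_left hv.le]
      linarith [le_max_left (v z s) 0]

lemma IsAdjointSolutionOn.integral_sq_posPart_le {f r : ℝ → ℝ} {τ F R : ℝ} {y p : ℝ → ℝ → ℝ}
    (hp : IsAdjointSolutionOn f r y τ p)
    (hF : ∀ x ∈ Icc (0 : ℝ) 1, ∀ t ∈ Icc 0 τ, |deriv f (y x t)| ≤ F)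
    (hR : ∀ x ∈ Icc (0 : ℝ) 1, ∀ t ∈ Icc 0 τ, |deriv r (y x t)| ≤ R)
    (σ : ℝ) {t : ℝ} (ht : t ∈ Icc 0 τ) :
    ∫ x in (0 : ℝ)..1, max (σ * Real.exp (R * t) * p x t) 0 ^ 2 ≤
      (∫ x in (0 : ℝ)..1, max (σ * Real.exp (R * τ) * p x τ) 0 ^ 2)
        * Real.exp (F ^ 2 / 2 * (τ - t)) := by
  obtain ⟨hpc, hp2, hpb, hpt⟩ := hp
  have hF0 : 0 ≤ F := (abs_nonneg _).trans (hF 0 (left_mem_Icc.2 zero_le_one) t ht)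
  refine _root_.integral_sq_posPart_le (v := fun x s => σ * Real.exp (R * s) * p x s) hF0 ?_
    (fun s hs => by simp [hpb s hs]) ?_ ht
  · have : Continuous fun z : ℝ × ℝ => σ * Real.exp (R * z.2) := by fun_prop
    exact this.continuousOn.mul hpc
  · intro x hx s hs hv
    have hs' : s ∈ Icc 0 τ := Ico_subset_Icc_self hs
    have hx' : x ∈ Icc (0 : ℝ) 1 := Ioo_subset_Icc_self hx
    set c := σ * Real.exp (R * s) with hc
    have hsmooth : ContDiffOn ℝ 2 (fun z => p z s) (Ioo 0 1) :=
      (hp2 s hs').mono Ioo_subset_Icc_self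
    have hd : ∀ᶠ z in 𝓝 x, DifferentiableAt ℝ (fun z => p z s) z := by
      filter_upwards [Ioo_mem_nhds hx.1 hx.2] with z hz
      exact (hsmooth.differentiableOn (by norm_num)).differentiableAt (Ioo_mem_nhds hz.1 hz.2)
    have hdd : DifferentiableAt ℝ (deriv fun z => p z s) x := by
      have h1 : ContDiffOn ℝ 1 (deriv fun z => p z s) (Ioo 0 1) :=
        hsmooth.deriv_of_isOpen isOpen_Ioo (by norm_num)
      exact (h1.differentiableOn (by norm_num)).differentiableAt (Ioo_mem_nhds hx.1 hx.2)
    have e1 : (deriv fun z => c * p z s) = fun z => c * deriv (fun z => p z s) z := by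
      funext z
      exact deriv_const_mul_field c
    have e2 : deriv (deriv fun z => c * p z s) x = c * deriv (deriv fun z => p z s) x := by
      rw [e1]
      exact deriv_const_mul_field c
    have hsj : IsSubjet (fun z => c * p z s) x _ _ := isSubjet_deriv
      (hd.mono fun z hz => hz.const_mul c) (by rw [e1]; exact hdd.const_mul c)
    rw [e2, e1] at hsj
    have hcs : HasDerivAt (fun s => σ * Real.exp (R * s)) (R * c) s := by
      have := (((hasDerivAt_id s).const_mul R).exp).const_mul σ
      convert! this using 1
      simp only [id, hc]; ring
    refine ⟨_, _, _, hcs.hasDerivWithinAt.mul (hpt x hx s hs'), hsj, ?_⟩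
    have hf1 : deriv f (y x s) * (c * deriv (fun z => p z s) x)
        ≤ F * |c * deriv (fun z => p z s) x| := by
      refine (le_abs_self _).trans ?_
      rw [abs_mul]
      exact mul_le_mul_of_nonneg_right (hF x hx' s hs') (abs_nonneg _)
    have hr1 : deriv r (y x s) * (c * p x s) ≤ R * (c * p x s) :=
      mul_le_mul_of_nonneg_right ((le_abs_self _).trans (hR x hx' s hs')) hv.le
    linarith

lemma IsAdjointSolutionOn.integral_sq_le {f r : ℝ → ℝ} {τ F R : ℝ} {y p : ℝ → ℝ → ℝ}
    (hp : IsAdjointSolutionOn f r y τ p)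
    (hF : ∀ x ∈ Icc (0 : ℝ) 1, ∀ t ∈ Icc 0 τ, |deriv f (y x t)| ≤ F)
    (hR : ∀ x ∈ Icc (0 : ℝ) 1, ∀ t ∈ Icc 0 τ, |deriv r (y x t)| ≤ R)
    {t : ℝ} (ht : t ∈ Icc 0 τ) :
    ∫ x in (0 : ℝ)..1, p x t ^ 2 ≤
      (∫ x in (0 : ℝ)..1, p x τ ^ 2) * Real.exp ((R + F ^ 2 / 4) * (τ - t)) ^ 2 := by
  have hsplit : ∀ s ∈ Icc 0 τ,
      (∫ x in (0 : ℝ)..1, max (1 * Real.exp (R * s) * p x s) 0 ^ 2)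
        + (∫ x in (0 : ℝ)..1, max (-1 * Real.exp (R * s) * p x s) 0 ^ 2)
      = Real.exp (R * s) ^ 2 * ∫ x in (0 : ℝ)..1, p x s ^ 2 := by
    intro s hs
    have hcont : ContinuousOn (fun x => p x s) (uIcc 0 1) := by
      rw [uIcc_of_le zero_le_one]
      exact hp.1.comp (f := fun x : ℝ => (x, s)) (by fun_prop) fun x hx => ⟨hx, hs⟩
    have hi : ∀ σ : ℝ, IntervalIntegrable
        (fun x => max (σ * Real.exp (R * s) * p x s) 0 ^ 2) volume 0 1 := fun σ =>
      ContinuousOn.intervalIntegrable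
        (((continuousOn_const.mul hcont).sup continuousOn_const).pow 2)
    rw [← intervalIntegral.integral_add (hi 1) (hi (-1)), ← intervalIntegral.integral_const_mul]
    refine intervalIntegral.integral_congr fun x _ => ?_
    rcases le_total 0 (Real.exp (R * s) * p x s) with h | h
    · rw [max_eq_left (by linarith), max_eq_right (by linarith)]
      ring
    · rw [max_eq_right (by linarith), max_eq_left (by linarith)]
      ring
  have h1 := hp.integral_sq_posPart_le hF hR 1 ht
  have h2 := hp.integral_sq_posPart_le hF hR (-1) ht
  have h3 := add_le_add h1 h2
  rw [← add_mul, hsplit t ht, hsplit τ ⟨ht.1.trans ht.2, le_rfl⟩] at h3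
  have e : Real.exp (R * t) ^ 2 * Real.exp ((R + F ^ 2 / 4) * (τ - t)) ^ 2
      = Real.exp (R * τ) ^ 2 * Real.exp (F ^ 2 / 2 * (τ - t)) := by
    simp only [← Real.exp_nat_mul, ← Real.exp_add]
    congr 1
    push_cast
    ring
  refine le_of_mul_le_mul_left ?_ (pow_pos (Real.exp_pos (R * t)) 2)
  calc _ ≤ _ := h3
    _ = (∫ x in (0 : ℝ)..1, p x τ ^ 2)
        * (Real.exp (R * τ) ^ 2 * Real.exp (F ^ 2 / 2 * (τ - t))) := by ring
    _ = _ := by rw [← e]; ring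

/-- `‖p(·,t)‖ ≤ ‖p(·,τ)‖ e^{β(τ−t)}` with `β = R₁(B) + F₁(B)²/4`. -/
theorem adjoint_L2_bound
    (f r : ℝ → ℝ) (hf : ContDiff ℝ 2 f) (hr : ContDiff ℝ 2 r)
    (B : ℝ) (hB : 0 < B)
    (τ : ℝ) (hτ : 0 < τ) (y p : ℝ → ℝ → ℝ)
    (hy : IsClassicalSolutionOnIoc f r τ y)
    (hyB : ∀ x ∈ Icc (0:ℝ) 1, ∀ t ∈ Icc (0:ℝ) τ, |y x t| ≤ B)
    (hp : IsAdjointSolutionOn f r y τ p) :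
    ∀ t ∈ Icc (0:ℝ) τ,
      Real.sqrt (∫ x in (0:ℝ)..1, (p x t) ^ 2) ≤
        Real.sqrt (∫ x in (0:ℝ)..1, (p x τ) ^ 2) *
          Real.exp ((sSup ((fun s => |deriv r s|) '' Icc (-B) B)
            + (sSup ((fun s => |deriv f s|) '' Icc (-B) B)) ^ 2 / 4) * (τ - t)) := by
  intro t ht
  have hbd : ∀ g : ℝ → ℝ, ContDiff ℝ 2 g → ∀ x ∈ Icc (0 : ℝ) 1, ∀ t ∈ Icc (0 : ℝ) τ,
      |deriv g (y x t)| ≤ sSup ((fun s => |deriv g s|) '' Icc (-B) B) := by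
    intro g hg x hx t ht
    have hc : Continuous fun s => |deriv g s| := (hg.continuous_deriv (by norm_num)).abs
    exact le_csSup (isCompact_Icc.bddAbove_image hc.continuousOn)
      ⟨_, abs_le.1 (hyB x hx t ht), rfl⟩
  refine (Real.sqrt_le_sqrt (hp.integral_sq_le (hbd f hf) (hbd r hr) ht)).trans_eq ?_
  rw [Real.sqrt_mul' _ (sq_nonneg _), Real.sqrt_sq (Real.exp_pos _).le]
end
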